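/- A finitely complete category C is diexact if and only if C is Barr-exact and adhesive. -/

import Mathlib

open CategoryTheory CategoryTheory.Limits

universe v u

section Defs

variable {C : Type u} [Category.{v} C]

/-- A span `(f, g)` is *jointly monic* if `u ≫ f = v ≫ f` and `u ≫ g = v ≫ g` imply `u = v`
(equivalently, the induced map into the product is a monomorphism). -/
def JointlyMonic {Z A B : C} (f : Z ⟶ A) (g : Z ⟶ B) : Prop :=
  ∀ ⦃X : C⦄ (u v : X ⟶ Z), u ≫ f = v ≫ f → u ≫ g = v ≫ g → u = v

/-- `(P, π₁, π₂, π₃)` is the limit `C ×_B C ×_A C` of triples `(c₁, c₂, c₃)` of generalized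
elements of `Z` with `g ∘ π₁ = g ∘ π₂` and `f ∘ π₂ = f ∘ π₃`. -/
structure IsTripleLimit {Z A B : C} (f : Z ⟶ A) (g : Z ⟶ B) {P : C}
    (π₁ π₂ π₃ : P ⟶ Z) : Prop where
  w₁ : π₁ ≫ g = π₂ ≫ g
  w₂ : π₂ ≫ f = π₃ ≫ f
  lift : ∀ ⦃X : C⦄ (x₁ x₂ x₃ : X ⟶ Z), x₁ ≫ g = x₂ ≫ g → x₂ ≫ f = x₃ ≫ f →
    ∃! u : X ⟶ P, u ≫ π₁ = x₁ ∧ u ≫ π₂ = x₂ ∧ u ≫ π₃ = x₃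

/-- A jointly monic span `(f, g)` is a *Mal'cev span* if, for the limit
`P = C ×_B C ×_A C`, there exists `p : P ⟶ C` with `f ∘ p = f ∘ π₁` and `g ∘ p = g ∘ π₃`. -/
def IsMalcevSpan {Z A B : C} (f : Z ⟶ A) (g : Z ⟶ B) : Prop :=
  JointlyMonic f g ∧
  ∀ ⦃P : C⦄ (π₁ π₂ π₃ : P ⟶ Z), IsTripleLimit f g π₁ π₂ π₃ →
    ∃ p : P ⟶ Z, p ≫ f = π₁ ≫ f ∧ p ≫ g = π₃ ≫ g

/-- A commuting square (with legs `f, g` and colegs `h, k`) is *stable under pullback* if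
every commutative cube over it whose four side faces are pullbacks has a pushout top face. -/
def PushoutStable {Z A B D : C} (f : Z ⟶ A) (g : Z ⟶ B) (h : A ⟶ D) (k : B ⟶ D) : Prop :=
  ∀ ⦃Z' A' B' D' : C⦄ (f' : Z' ⟶ A') (g' : Z' ⟶ B') (h' : A' ⟶ D') (k' : B' ⟶ D')
    (αZ : Z' ⟶ Z) (αA : A' ⟶ A) (αB : B' ⟶ B) (αD : D' ⟶ D),
    IsPullback f' αZ αA f → IsPullback g' αZ αB g →
    IsPullback h' αA αD h → IsPullback k' αB αD k →
    f' ≫ h' = g' ≫ k' → IsPushout f' g' h' k'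

/-- A category is *diexact* if every Mal'cev span admits a pushout, and every pushout square
of a Mal'cev span is stable under pullback and is itself a pullback square. -/
def Diexact (C : Type u) [Category.{v} C] : Prop :=
  ∀ ⦃Z A B : C⦄ (f : Z ⟶ A) (g : Z ⟶ B), IsMalcevSpan f g →
    (∃ (D : C) (h : A ⟶ D) (k : B ⟶ D), IsPushout f g h k) ∧
    ∀ ⦃D : C⦄ (h : A ⟶ D) (k : B ⟶ D), IsPushout f g h k →
      PushoutStable f g h k ∧ IsPullback f g h k

/-- An internal equivalence relation: a jointly monic pair which is reflexive, symmetric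
and transitive. -/
def IsEquivRelation [HasPullbacks C] {E A : C} (s t : E ⟶ A) : Prop :=
  JointlyMonic s t ∧
  (∃ r : A ⟶ E, r ≫ s = 𝟙 A ∧ r ≫ t = 𝟙 A) ∧
  (∃ σ : E ⟶ E, σ ≫ s = t ∧ σ ≫ t = s) ∧
  (∃ τ : pullback t s ⟶ E,
     τ ≫ s = pullback.fst t s ≫ s ∧ τ ≫ t = pullback.snd t s ≫ t)

/-- A finitely complete category is *Barr-exact* if every kernel pair has a coequaliser,
regular epimorphisms are stable under pullback, and every internal equivalence relation is
effective (i.e. a kernel pair). -/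
def BarrExact (C : Type u) [Category.{v} C] [HasFiniteLimits C] : Prop :=
  (∀ ⦃X Y : C⦄ (f : X ⟶ Y), HasCoequalizer (pullback.fst f f) (pullback.snd f f)) ∧
  (∀ ⦃X Y W : C⦄ (f : X ⟶ Y) (g : W ⟶ Y),
     Nonempty (RegularEpi f) → Nonempty (RegularEpi (pullback.snd f g))) ∧
  (∀ ⦃E A : C⦄ (s t : E ⟶ A), IsEquivRelation s t →
     ∃ (Q : C) (q : A ⟶ Q), IsPullback s t q q)

/-- A category is *amalgamable* if every span of monomorphisms admits a pushout which is
stable under pullback and is itself a pullback square. -/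
def Amalgamable (C : Type u) [Category.{v} C] : Prop :=
  ∀ ⦃Z A B : C⦄ (f : Z ⟶ A) (g : Z ⟶ B), Mono f → Mono g →
    ∃ (D : C) (h : A ⟶ D) (k : B ⟶ D),
      IsPushout f g h k ∧ PushoutStable f g h k ∧ IsPullback f g h k

/-- A category is *adhesive* if it admits pushouts along monomorphisms, and these pushouts
are stable under pullback and are pullback squares. -/
def AdhesiveCat (C : Type u) [Category.{v} C] : Prop :=
  ∀ ⦃Z A B : C⦄ (f : Z ⟶ A) (g : Z ⟶ B), Mono f →
    (∃ (D : C) (h : A ⟶ D) (k : B ⟶ D), IsPushout f g h k) ∧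
    ∀ ⦃D : C⦄ (h : A ⟶ D) (k : B ⟶ D), IsPushout f g h k →
      PushoutStable f g h k ∧ IsPullback f g h k

/-- `u` factors through `v` (as morphisms into a common object `X`). -/
def FactorsThru {U V X : C} (u : U ⟶ X) (v : V ⟶ X) : Prop :=
  ∃ w : U ⟶ V, w ≫ v = u

/-- A monomorphism `m : P ⟶ X` is the *union* of the subobjects `a : A ⟶ X` and `b : B ⟶ X`:
both factor through `m`, and `m` factors through any monomorphism through which both factor. -/
def IsUnionOf {A B P X : C} (a : A ⟶ X) (b : B ⟶ X) (m : P ⟶ X) : Prop :=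
  Mono m ∧ FactorsThru a m ∧ FactorsThru b m ∧
  ∀ ⦃Q : C⦄ (c : Q ⟶ X), Mono c → FactorsThru a c → FactorsThru b c → FactorsThru m c

end Defs

section

variable {C : Type u} [Category.{v} C]

section PushoutStable

lemma PushoutStable.flip {Z A B D : C} {f : Z ⟶ A} {g : Z ⟶ B} {h : A ⟶ D} {k : B ⟶ D}
    (H : PushoutStable f g h k) : PushoutStable g f k h :=
  fun _ _ _ _ f' g' h' k' αZ αA αB αD hf hg hh hk w ↦
    (H g' f' k' h' αZ αB αA αD hg hf hk hh w.symm).flip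

lemma PushoutStable.of_comp_iso {Z A B D D' : C} {f : Z ⟶ A} {g : Z ⟶ B} {h : A ⟶ D}
    {k : B ⟶ D} (e : D ≅ D') (H : PushoutStable f g (h ≫ e.hom) (k ≫ e.hom)) :
    PushoutStable f g h k := by
  intro Z' A' B' E f' g' h' k' αZ αA αB αE hf hg hh hk w
  refine H f' g' h' k' αZ αA αB (αE ≫ e.hom) hf hg ?_ ?_ w
  · exact hh.of_iso (Iso.refl _) (Iso.refl _) (Iso.refl _) e
      (by simp) (by simp) (by simp) (by simp)
  · exact hk.of_iso (Iso.refl _) (Iso.refl _) (Iso.refl _) e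
      (by simp) (by simp) (by simp) (by simp)

/-- Stable squares are closed under horizontal pasting. -/
lemma PushoutStable.paste_horiz [HasPullbacks C] {Z X A B Y D : C} {f : Z ⟶ X} {g : Z ⟶ B}
    {h : X ⟶ Y} {k : B ⟶ Y} {m : X ⟶ A} {a : A ⟶ D} {b : Y ⟶ D}
    (H : PushoutStable f g h k) (w₁ : f ≫ h = g ≫ k)
    (H' : PushoutStable m h a b) (w₂ : m ≫ a = h ≫ b) :
    PushoutStable (f ≫ m) g a (k ≫ b) := by
  intro Z' A' B' D' f' g' a' k' αZ αA αB αD hf hg ha hk w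
  have hX := IsPullback.of_hasPullback αA m
  have hY := IsPullback.of_hasPullback αD b
  have hf' := hf.of_right' hX
  have hk' := hk.of_right' hY
  have hXD : IsPullback (pullback.fst αA m ≫ a') (pullback.snd αA m) αD (h ≫ b) :=
    w₂ ▸ hX.paste_horiz ha
  have hh' := hXD.of_right' hY
  have P₁ := H _ g' _ _ αZ (pullback.snd αA m) αB (pullback.snd αD b) hf' hg hh' hk' (by
    apply hY.hom_ext
    · simp only [Category.assoc, IsPullback.lift_fst, IsPullback.lift_fst_assoc, w]
    · simp only [Category.assoc, IsPullback.lift_snd, IsPullback.lift_snd_assoc, w₁, hg.w_assoc])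
  have P₂ := H' _ _ a' _ (pullback.snd αA m) αA (pullback.snd αD b) αD hX hh' ha hY
    (by simp only [IsPullback.lift_fst])
  simpa only [IsPullback.lift_fst] using P₁.paste_horiz P₂

/-- A square which is a pushout stable under pullback, and itself a pullback. -/
structure IsStableExactSquare {Z A B D : C} (f : Z ⟶ A) (g : Z ⟶ B) (h : A ⟶ D) (k : B ⟶ D) :
    Prop where
  isPushout : IsPushout f g h k
  stable : PushoutStable f g h k
  isPullback : IsPullback f g h k

namespace IsStableExactSquare

lemma flip {Z A B D : C} {f : Z ⟶ A} {g : Z ⟶ B} {h : A ⟶ D} {k : B ⟶ D}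
    (H : IsStableExactSquare f g h k) : IsStableExactSquare g f k h :=
  ⟨H.isPushout.flip, H.stable.flip, H.isPullback.flip⟩

lemma paste_horiz [HasPullbacks C] {Z X A B Y D : C} {f : Z ⟶ X} {g : Z ⟶ B}
    {h : X ⟶ Y} {k : B ⟶ Y} {m : X ⟶ A} {a : A ⟶ D} {b : Y ⟶ D}
    (H : IsStableExactSquare f g h k) (H' : IsStableExactSquare m h a b) :
    IsStableExactSquare (f ≫ m) g a (k ≫ b) :=
  ⟨H.isPushout.paste_horiz H'.isPushout,
    H.stable.paste_horiz H.isPushout.w H'.stable H'.isPushout.w,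
    H.isPullback.flip.paste_vert H'.isPullback.flip |>.flip⟩

lemma of_isPushout {Z A B D D' : C} {f : Z ⟶ A} {g : Z ⟶ B} {h : A ⟶ D} {k : B ⟶ D}
    {h' : A ⟶ D'} {k' : B ⟶ D'} (H : IsStableExactSquare f g h k) (H' : IsPushout f g h' k') :
    IsStableExactSquare f g h' k' := by
  let e := H'.isoIsPushout _ _ H.isPushout
  have hh : h' ≫ e.hom = h := H'.inl_isoIsPushout_hom _ _ H.isPushout
  have hk : k' ≫ e.hom = k := H'.inr_isoIsPushout_hom _ _ H.isPushout
  refine ⟨H', .of_comp_iso e (by rw [hh, hk]; exact H.stable), ?_⟩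
  exact H.isPullback.of_iso (Iso.refl _) (Iso.refl _) (Iso.refl _) e.symm (by simp) (by simp)
    (by simp [← hh]) (by simp [← hk])

end IsStableExactSquare

end PushoutStable

section Regular

lemma CategoryTheory.IsRegularEpi.exists_fac {X Y W : C} (e : X ⟶ Y) [IsRegularEpi e] (c : X ⟶ W)
    (h : ∀ ⦃T : C⦄ (u v : T ⟶ X), u ≫ e = v ≫ e → u ≫ c = v ≫ c) : ∃ l : Y ⟶ W, e ≫ l = c :=
  ⟨IsRegularEpi.desc e c (h _ _ (IsRegularEpi.w e)), IsRegularEpi.fac e c _⟩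

/-- A pullback square whose legs and diagonal are regular epimorphisms is a pushout. -/
lemma CategoryTheory.IsPullback.isPushout_of_isRegularEpi {Z X Y Q : C} {f : Z ⟶ X} {g : Z ⟶ Y}
    {h : X ⟶ Q} {k : Y ⟶ Q} (H : IsPullback f g h k) [IsRegularEpi f] [IsRegularEpi g]
    [IsRegularEpi (f ≫ h)] : IsPushout f g h k := by
  have : Epi f := (IsRegularEpi.getStruct f).epi
  have : Epi g := (IsRegularEpi.getStruct g).epi
  have : Epi (f ≫ h) := (IsRegularEpi.getStruct (f ≫ h)).epi
  have : Epi h := epi_of_epi f h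
  refine IsPushout.mk' H.w (fun T φ φ' hφ _ ↦ by rwa [cancel_epi] at hφ) fun T a b hab ↦ ?_
  obtain ⟨l, hl⟩ := IsRegularEpi.exists_fac (f ≫ h) (f ≫ a) (by
    intro T u v huv
    obtain ⟨t, ht₁, ht₂⟩ := H.exists_lift (u ≫ f) (v ≫ g) (by simpa [H.w] using huv)
    rw [← reassoc_of% ht₁, hab, reassoc_of% ht₂])
  have hl' : h ≫ l = a := by rw [← cancel_epi f, ← hl, Category.assoc]
  exact ⟨l, hl', by rw [← cancel_epi g, ← hab, ← hl', H.w_assoc]⟩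

/-- In a regular category, a pullback square whose legs and diagonal are regular epimorphisms is
a stable pushout. -/
lemma CategoryTheory.IsPullback.isStableExactSquare_of_isRegularEpi [Regular C]
    {Z X Y Q : C} {f : Z ⟶ X} {g : Z ⟶ Y} {h : X ⟶ Q} {k : Y ⟶ Q} (H : IsPullback f g h k)
    [hf : IsRegularEpi f] [hg : IsRegularEpi g] [hh : IsRegularEpi (f ≫ h)] :
    IsStableExactSquare f g h k := by
  refine ⟨H.isPushout_of_isRegularEpi, ?_, H⟩
  intro Z' X' Y' Q' f' g' h' k' αZ αX αY αQ pf pg ph pk w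
  have base {A B A' B' : C} {u : A ⟶ B} {u' : A' ⟶ B'} {a : A' ⟶ A} {b : B' ⟶ B}
      (p : IsPullback u' a b u) (hu : IsRegularEpi u) : IsRegularEpi u' :=
    Regular.regularEpiIsStableUnderBaseChange.of_isPullback p.flip hu
  have := base pf hf
  have := base pg hg
  have := base (pf.paste_horiz ph) hh
  have top : IsPullback f' (g' ≫ αY) (h' ≫ αQ) k := by
    rw [ph.w, pg.w]
    exact pf.paste_vert H
  exact (top.of_bot w pk).isPushout_of_isRegularEpi

/-- A jointly monic span of regular epimorphisms such that the relation of being joined by a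
zigzag of length two is the kernel pair of a regular epimorphism is the pullback of a stable
pushout. -/
lemma JointlyMonic.exists_isStableExactSquare [Regular C] {Z X Y Q : C} {f : Z ⟶ X} {g : Z ⟶ Y}
    (H : JointlyMonic f g) [hf : IsRegularEpi f] [hg : IsRegularEpi g] (q : Z ⟶ Q)
    [hq : IsRegularEpi q]
    (hq₁ : ∀ ⦃T : C⦄ (x y : T ⟶ Z), x ≫ q = y ≫ q → ∃ z, z ≫ f = x ≫ f ∧ z ≫ g = y ≫ g)
    (hq₂ : ∀ ⦃T : C⦄ (x y z : T ⟶ Z), z ≫ f = x ≫ f → z ≫ g = y ≫ g → x ≫ q = y ≫ q) :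
    ∃ (h : X ⟶ Q) (k : Y ⟶ Q), IsStableExactSquare f g h k := by
  obtain ⟨h, hh⟩ := IsRegularEpi.exists_fac f q fun T u v huv ↦ hq₂ u v v huv.symm rfl
  obtain ⟨k, hk⟩ := IsRegularEpi.exists_fac g q fun T u v huv ↦ hq₂ u v u rfl huv
  have : IsRegularEpi (f ≫ h) := hh ▸ hq
  refine ⟨h, k, IsPullback.isStableExactSquare_of_isRegularEpi ?_⟩
  refine IsPullback.mk' (hh.trans hk.symm) (fun T φ φ' ↦ H φ φ') fun T a b hab ↦ ?_
  let p := pullback.snd f a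
  let r := pullback.snd g (p ≫ b)
  obtain ⟨z, hz₁, hz₂⟩ := hq₁ (r ≫ pullback.fst f a) (pullback.fst g (p ≫ b)) (by
    simp only [Category.assoc]
    rw [← hh, pullback.condition_assoc, hab, hh, ← hk, pullback.condition_assoc, Category.assoc])
  have : StrongEpi (r ≫ p) := strongEpi_comp r p
  obtain ⟨l, hl⟩ := IsRegularEpi.exists_fac (r ≫ p) z fun S u v huv ↦ by
    apply H
    · simp only [Category.assoc, hz₁, pullback.condition]
      simpa [p] using huv =≫ a
    · simp only [Category.assoc, hz₂, pullback.condition]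
      simpa [r] using huv =≫ b
  refine ⟨l, ?_, ?_⟩
  · rw [← cancel_epi (r ≫ p), ← Category.assoc, hl, hz₁, Category.assoc, pullback.condition,
      Category.assoc]
  · rw [← cancel_epi (r ≫ p), ← Category.assoc, hl, hz₂, pullback.condition, Category.assoc]

end Regular

section Malcev

lemma isMalcevSpan_iff [HasPullbacks C] {Z A B : C} {f : Z ⟶ A} {g : Z ⟶ B} :
    IsMalcevSpan f g ↔ JointlyMonic f g ∧ ∀ ⦃T : C⦄ (x₁ x₂ x₃ : T ⟶ Z), x₁ ≫ g = x₂ ≫ g →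
      x₂ ≫ f = x₃ ≫ f → ∃ y, y ≫ f = x₁ ≫ f ∧ y ≫ g = x₃ ≫ g := by
  refine ⟨fun H ↦ ⟨H.1, fun T x₁ x₂ x₃ h₁ h₂ ↦ ?_⟩,
    fun H ↦ ⟨H.1, fun P π₁ π₂ π₃ h ↦ H.2 π₁ π₂ π₃ h.w₁ h.w₂⟩⟩
  let p := pullback.fst (pullback.snd g g ≫ f) f
  have lim : IsTripleLimit f g (p ≫ pullback.fst g g) (p ≫ pullback.snd g g)
      (pullback.snd (pullback.snd g g ≫ f) f) := by
    refine ⟨by simp [pullback.condition], by simp [p, pullback.condition], ?_⟩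
    intro T x₁ x₂ x₃ h₁ h₂
    refine ⟨pullback.lift (pullback.lift x₁ x₂ h₁) x₃
      (by simpa only [pullback.lift_snd_assoc] using h₂),
      by simp only [p, pullback.lift_fst, pullback.lift_snd, pullback.lift_fst_assoc, and_self], ?_⟩
    rintro u ⟨hu₁, hu₂, hu₃⟩
    apply pullback.hom_ext
    · apply pullback.hom_ext
      · simpa only [Category.assoc, pullback.lift_fst] using hu₁
      · simpa only [Category.assoc, pullback.lift_fst, pullback.lift_snd] using hu₂
    · simpa only [pullback.lift_snd] using hu₃
  obtain ⟨y, hy₁, hy₂⟩ := H.2 _ _ _ lim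
  obtain ⟨u, ⟨rfl, rfl, rfl⟩, -⟩ := lim.lift x₁ x₂ x₃ h₁ h₂
  exact ⟨u ≫ y, by simp [hy₁], by simp [hy₂]⟩

lemma isMalcevSpan_of_mono [HasPullbacks C] {Z A B : C} (f : Z ⟶ A) (g : Z ⟶ B) [Mono f] :
    IsMalcevSpan f g := by
  refine isMalcevSpan_iff.2 ⟨fun T u v h _ ↦ by rwa [cancel_mono] at h,
    fun T x₁ x₂ x₃ h₁ h₂ ↦ ⟨x₁, rfl, ?_⟩⟩
  rw [h₁, (cancel_mono f).1 h₂]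

lemma IsEquivRelation.isMalcevSpan [HasPullbacks C] {E A : C} {s t : E ⟶ A}
    (H : IsEquivRelation s t) : IsMalcevSpan s t := by
  obtain ⟨hm, -, ⟨σ, hσ₁, hσ₂⟩, τ, hτ₁, hτ₂⟩ := H
  have trans {T : C} (x y : T ⟶ E) (h : x ≫ t = y ≫ s) :
      ∃ z : T ⟶ E, z ≫ s = x ≫ s ∧ z ≫ t = y ≫ t :=
    ⟨pullback.lift x y h ≫ τ, by rw [Category.assoc, hτ₁, pullback.lift_fst_assoc],
      by rw [Category.assoc, hτ₂, pullback.lift_snd_assoc]⟩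
  refine isMalcevSpan_iff.2 ⟨hm, fun T x₁ x₂ x₃ h₁ h₂ ↦ ?_⟩
  obtain ⟨y, hy₁, hy₂⟩ := trans x₁ (x₂ ≫ σ) (by simp [hσ₁, h₁])
  obtain ⟨z, hz₁, hz₂⟩ := trans y x₃ (by simp [hy₂, hσ₂, h₂])
  exact ⟨z, hz₁.trans hy₁, hz₂⟩

lemma CategoryTheory.IsKernelPair.isEquivRelation [HasPullbacks C] {X Y E : C} {q : X ⟶ Y}
    {s t : E ⟶ X} (H : IsKernelPair q s t) : IsEquivRelation s t := by
  refine ⟨fun T u v ↦ H.hom_ext, ?_, ?_, ?_⟩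
  · exact H.exists_lift (𝟙 X) (𝟙 X) rfl
  · exact H.exists_lift t s H.w.symm
  · exact H.exists_lift _ _ (by
      rw [Category.assoc, Category.assoc, H.w, pullback.condition_assoc, H.w])

/-- The zigzag relation on the apex of a Mal'cev span is an equivalence relation. -/
lemma IsMalcevSpan.exists_isEquivRelation [HasPullbacks C] {Z A B : C} {f : Z ⟶ A} {g : Z ⟶ B}
    (H : IsMalcevSpan f g) : ∃ (E : C) (s t : E ⟶ Z), IsEquivRelation s t ∧
      ∀ ⦃T : C⦄ (x y : T ⟶ Z), (∃ u : T ⟶ E, u ≫ s = x ∧ u ≫ t = y) ↔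
        ∃ z, z ≫ f = x ≫ f ∧ z ≫ g = y ≫ g := by
  obtain ⟨hm, hfg⟩ := isMalcevSpan_iff.1 H
  let p := pullback.fst (pullback.snd f f ≫ g) g
  let s := p ≫ pullback.fst f f
  let t := pullback.snd (pullback.snd f f ≫ g) g
  have hs : (p ≫ pullback.snd f f) ≫ f = s ≫ f := by simp [s, pullback.condition]
  have ht : (p ≫ pullback.snd f f) ≫ g = t ≫ g := by simp [p, t, pullback.condition]
  have rel {T : C} (x y : T ⟶ Z) : (∃ u, u ≫ s = x ∧ u ≫ t = y) ↔
      ∃ z, z ≫ f = x ≫ f ∧ z ≫ g = y ≫ g := by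
    constructor
    · rintro ⟨u, rfl, rfl⟩
      exact ⟨u ≫ p ≫ pullback.snd f f, by simpa using u ≫= hs, by simpa using u ≫= ht⟩
    · rintro ⟨z, hz₁, hz₂⟩
      exact ⟨pullback.lift (pullback.lift x z hz₁.symm) y
        (by rwa [pullback.lift_snd_assoc]),
        by simp only [s, p, pullback.lift_fst, pullback.lift_fst_assoc], pullback.lift_snd _ _ _⟩
  refine ⟨_, s, t, ⟨?_, ?_, ?_, ?_⟩, fun T ↦ rel⟩
  · intro T u v h₁ h₂
    have h₃ : u ≫ p ≫ pullback.snd f f = v ≫ p ≫ pullback.snd f f := by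
      apply hm
      · simpa [hs] using h₁ =≫ f
      · simpa [ht] using h₂ =≫ g
    apply pullback.hom_ext
    · apply pullback.hom_ext
      · simpa [s] using h₁
      · simpa using h₃
    · exact h₂
  · exact (rel _ _).2 ⟨𝟙 Z, rfl, rfl⟩
  · exact (rel _ _).2 (hfg t (p ≫ pullback.snd f f) s ht.symm hs)
  · refine (rel _ _).2 ?_
    obtain ⟨y, hy₁, hy₂⟩ := hfg (pullback.fst t s ≫ p ≫ pullback.snd f f) (pullback.fst t s ≫ t)
      (pullback.snd t s ≫ p ≫ pullback.snd f f) (by simpa using _ ≫= ht)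
      (by rw [pullback.condition]; simpa using (_ ≫= hs).symm)
    refine ⟨y, hy₁.trans ?_, hy₂.trans ?_⟩
    · simpa using _ ≫= hs
    · simpa using _ ≫= ht

end Malcev

section Main

lemma BarrExact.regular [HasFiniteLimits C] (H : BarrExact C) : Regular C where
  hasCoequalizer_of_isKernelPair {X Y Z f g₁ g₂} h := by
    have := H.1 f
    exact hasColimit_of_iso (parallelPair.ext (G := parallelPair (pullback.fst f f)
      (pullback.snd f f)) h.isoPullback (Iso.refl _) (by simp) (by simp))
  regularEpiIsStableUnderBaseChange := .of_forall_exists_isPullback fun f g _ hg ↦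
    ⟨_, _, _, (IsPullback.of_hasPullback g f).flip, ⟨H.2.1 g f hg.regularEpi⟩⟩

lemma CategoryTheory.Regular.exists_image_fac [Regular C] {X Y : C} (f : X ⟶ Y) :
    ∃ (I : C) (e : X ⟶ I) (m : I ⟶ Y), IsRegularEpi e ∧ Mono m ∧ e ≫ m = f :=
  ⟨_, (Regular.strongEpiMonoFactorisation f).e, (Regular.strongEpiMonoFactorisation f).m,
    inferInstance, inferInstance, (Regular.strongEpiMonoFactorisation f).fac⟩

lemma AdhesiveCat.exists_isStableExactSquare (H : AdhesiveCat C) {Z A B : C} (f : Z ⟶ A)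
    (g : Z ⟶ B) [hf : Mono f] :
    ∃ (D : C) (h : A ⟶ D) (k : B ⟶ D), IsStableExactSquare f g h k := by
  obtain ⟨⟨D, h, k, hp⟩, H'⟩ := H f g hf
  exact ⟨D, h, k, hp, (H' h k hp).1, (H' h k hp).2⟩

lemma IsMalcevSpan.exists_isStableExactSquare [HasFiniteLimits C] (hC : BarrExact C)
    (hC' : AdhesiveCat C) {Z A B : C} {f : Z ⟶ A} {g : Z ⟶ B} (H : IsMalcevSpan f g) :
    ∃ (D : C) (h : A ⟶ D) (k : B ⟶ D), IsStableExactSquare f g h k := by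
  have := hC.regular
  obtain ⟨E, s, t, hE, rel⟩ := H.exists_isEquivRelation
  obtain ⟨Q, q, hQ⟩ := hC.2.2 s t hE
  obtain ⟨Q', q', n, hq', hn, rfl⟩ := Regular.exists_image_fac q
  obtain ⟨I, e, m, he, hm, rfl⟩ := Regular.exists_image_fac f
  obtain ⟨J, d, l, hd, hl, rfl⟩ := Regular.exists_image_fac g
  have rel' {T : C} (x y : T ⟶ Z) :
      x ≫ q' = y ≫ q' ↔ ∃ z, z ≫ e = x ≫ e ∧ z ≫ d = y ≫ d := by
    refine Iff.trans ⟨fun h ↦ hQ.exists_lift x y (by simpa using h =≫ n), ?_⟩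
      ((rel x y).trans (by simp only [← Category.assoc, cancel_mono]))
    rintro ⟨u, rfl, rfl⟩
    rw [← cancel_mono n]
    simpa using u ≫= hQ.w
  have hed : JointlyMonic e d := fun T u v h₁ h₂ ↦
    H.1 u v (by simpa using h₁ =≫ m) (by simpa using h₂ =≫ l)
  obtain ⟨i, j, hS⟩ := hed.exists_isStableExactSquare q' (fun T x y ↦ (rel' x y).1)
    (fun T x y z h₁ h₂ ↦ (rel' x y).2 ⟨z, h₁, h₂⟩)
  obtain ⟨A', a, a', hA⟩ := hC'.exists_isStableExactSquare m i
  obtain ⟨D, b, b', hD⟩ := hC'.exists_isStableExactSquare l (j ≫ a')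
  exact ⟨D, _, _, ((hS.paste_horiz hA).flip.paste_horiz hD).flip⟩

lemma Diexact.exists_isStableExactSquare (H : Diexact C) {Z A B : C} {f : Z ⟶ A} {g : Z ⟶ B}
    (hfg : IsMalcevSpan f g) :
    ∃ (D : C) (h : A ⟶ D) (k : B ⟶ D), IsStableExactSquare f g h k := by
  obtain ⟨⟨D, h, k, hp⟩, H'⟩ := H f g hfg
  exact ⟨D, h, k, hp, (H' h k hp).1, (H' h k hp).2⟩

lemma Diexact.adhesiveCat [HasPullbacks C] (H : Diexact C) : AdhesiveCat C :=
  fun _ _ _ f g _ ↦ H f g (isMalcevSpan_of_mono f g)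

/-- In a diexact category, an equivalence relation has a quotient of which it is the kernel pair,
and the quotient square is a stable pushout. -/
lemma Diexact.exists_quotient [HasPullbacks C] (H : Diexact C) {E A : C} {s t : E ⟶ A}
    (hE : IsEquivRelation s t) : ∃ (Q : C) (q : A ⟶ Q), IsStableExactSquare s t q q := by
  obtain ⟨Q, h, k, hQ⟩ := H.exists_isStableExactSquare hE.isMalcevSpan
  obtain ⟨-, ⟨r, hrs, hrt⟩, -⟩ := hE
  have hhk : h = k := by simpa [reassoc_of% hrs, reassoc_of% hrt] using r ≫= hQ.isPushout.w
  exact ⟨Q, h, hhk ▸ hQ⟩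

/-- A regular epimorphism is the pushout of its kernel pair against itself. -/
lemma CategoryTheory.IsKernelPair.isPushout {E A Q : C} {s t : E ⟶ A} {q : A ⟶ Q}
    [IsRegularEpi q] (H : IsKernelPair q s t) : IsPushout s t q q := by
  have : Epi q := (IsRegularEpi.getStruct q).epi
  refine IsPushout.mk' H.w (fun T φ φ' h _ ↦ by rwa [cancel_epi] at h) fun T a b hab ↦ ?_
  obtain ⟨r, hrs, hrt⟩ := H.exists_lift (𝟙 A) (𝟙 A) rfl
  obtain rfl : a = b := by simpa [reassoc_of% hrs, reassoc_of% hrt] using r ≫= hab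
  obtain ⟨l, hl⟩ := IsRegularEpi.exists_of_isKernelPair q H a hab
  exact ⟨l, hl, hl⟩

/-- A morphism which is the pushout of a parallel pair against itself is its coequalizer. -/
noncomputable def CategoryTheory.IsPushout.isColimitCofork {E A Q : C} {s t : E ⟶ A} {q : A ⟶ Q}
    (H : IsPushout s t q q) : IsColimit (Cofork.ofπ q H.w) :=
  Cofork.IsColimit.mk _ (fun c ↦ H.desc c.π c.π c.condition) (fun c ↦ H.inl_desc _ _ _)
    fun c m hm ↦ H.hom_ext (by simpa using hm) (by simpa using hm)

lemma Diexact.barrExact [HasFiniteLimits C] (H : Diexact C) : BarrExact C := by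
  refine ⟨fun X Y f ↦ ?_, fun X Y W f g ⟨hf⟩ ↦ ?_, fun E A s t hE ↦ ?_⟩
  · obtain ⟨Q, q, hq⟩ := H.exists_quotient (IsKernelPair.of_hasPullback f).isEquivRelation
    exact ⟨⟨⟨_, hq.isPushout.isColimitCofork⟩⟩⟩
  · have hK := IsKernelPair.of_hasPullback f
    have := isRegularEpi_of_regularEpi hf
    obtain ⟨Q, q, hq⟩ := H.exists_quotient hK.isEquivRelation
    have hS := (hq.of_isPushout hK.isPushout).stable
    have hX := (IsPullback.of_hasPullback f g).flip
    obtain ⟨P, p, p', hP⟩ : ∃ (P : C) (p : P ⟶ W) (p' : P ⟶ _),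
        IsPullback p p' g (pullback.fst f f ≫ f) :=
      ⟨_, _, _, .of_hasPullback _ _⟩
    have hP' := hP
    rw [pullback.condition] at hP'
    have h₁ := hP.of_right' hX
    have h₂ := hP'.of_right' hX
    have hp := hS _ _ _ _ _ _ _ _ h₁ h₂ hX hX
      ((hX.lift_fst _ _ _).trans (hX.lift_fst _ _ _).symm)
    exact ⟨⟨_, _, _, hp.w, hp.isColimitCofork⟩⟩
  · obtain ⟨Q, q, hq⟩ := H.exists_quotient hE
    exact ⟨Q, q, hq.isPullback⟩

end Main

end

/-- A finitely complete category is diexact if and only if it is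
Barr-exact and adhesive. -/
theorem diexact_iff_barrExact_adhesive {C : Type u} [Category.{v} C] [HasFiniteLimits C] :
    Diexact C ↔ (BarrExact C ∧ AdhesiveCat C) := by
  refine ⟨fun H ↦ ⟨H.barrExact, H.adhesiveCat⟩, fun ⟨H, H'⟩ Z A B f g hfg ↦ ?_⟩
  obtain ⟨D, h, k, hS⟩ := hfg.exists_isStableExactSquare H H'
  refine ⟨⟨D, h, k, hS.isPushout⟩, fun D' h' k' hp ↦ ?_⟩
  exact ⟨(hS.of_isPushout hp).stable, (hS.of_isPushout hp).isPullback⟩
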